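/- arXiv:1203.0100 — 6 statements merged into one kernel-verified Lean document; each statement's English description precedes it below -/
import Mathlib

section
/- The Last Diminisher mechanism produces a proportional allocation of contiguous slices: for any n agents with nonatomic probability measures u_1,...,u_n on [0,1], there exist cut points 0 = x_0 ≤ x_1 ≤ ... ≤ x_n = 1 and a permutation σ of {1,...,n} such that u_{σ(k)}([x_{k-1}, x_k]) ≥ 1/n for every k ∈ {1,...,n}. -/
open MeasureTheory ENNReal

/-- Last Diminisher on distribution functions: if each of `m + 1` continuous monotone functions
increases by at least `(m + 1) * c` on `[a, b]`, then `[a, b]` splits into `m + 1` contiguous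
slices that can be matched with the functions so that each increases by at least `c` on its own
slice. -/
theorem exists_cuts_of_continuous_monotone {c : ℝ} (hc : 0 ≤ c) {b : ℝ} (m : ℕ) (a : ℝ)
    (hab : a ≤ b) (f : Fin (m + 1) → ℝ → ℝ) (hmono : ∀ i, Monotone (f i))
    (hcont : ∀ i, Continuous (f i)) (hf : ∀ i, (m + 1) * c ≤ f i b - f i a) :
    ∃ (x : Fin (m + 2) → ℝ) (σ : Fin (m + 1) → Fin (m + 1)),
      Function.Injective σ ∧ x 0 = a ∧ x (Fin.last (m + 1)) = b ∧ Monotone x ∧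
      ∀ k, c ≤ f (σ k) (x k.succ) - f (σ k) (x k.castSucc) := by
  induction m generalizing a with
  | zero =>
    refine ⟨![a, b], id, Function.injective_id, rfl, rfl, ?_, fun k => ?_⟩
    · rw [Fin.monotone_iff_le_succ]
      intro k
      fin_cases k
      exact hab
    · have := hf k
      fin_cases k
      simpa using this
  | succ m ih =>
    push_cast at hf
    have hcut : ∀ i, ∃ t ∈ Set.Icc a b, f i t = f i a + c := fun i =>
      intermediate_value_Icc hab (hcont i).continuousOn
        ⟨by linarith, by nlinarith [hf i, mul_nonneg (Nat.cast_nonneg (α := ℝ) m) hc]⟩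
    choose t ht hft using hcut
    obtain ⟨i, hi⟩ := Finite.exists_min t
    obtain ⟨x, σ, hσ, hx0, hx1, hx, hval⟩ := ih (t i) (ht i).2 (fun k => f (i.succAbove k))
      (fun k => hmono _) (fun k => hcont _) (fun k => by
        have h1 := hmono (i.succAbove k) (hi (i.succAbove k))
        have h2 := hft (i.succAbove k)
        have h3 := hf (i.succAbove k)
        linarith)
    refine ⟨Fin.cons a x, Fin.cons i (i.succAbove ∘ σ), ?_, rfl, ?_, ?_, ?_⟩
    · rw [Fin.cons_injective_iff]
      refine ⟨?_, Fin.succAbove_right_injective.comp hσ⟩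
      rintro ⟨k, hk⟩
      exact Fin.succAbove_ne i (σ k) hk
    · rw [← Fin.succ_last, Fin.cons_succ, hx1]
    · rw [Fin.monotone_iff_le_succ]
      intro k
      cases k using Fin.cases with
      | zero => simpa [hx0] using (ht i).1
      | succ k =>
        rw [← Fin.succ_castSucc, Fin.cons_succ, Fin.cons_succ]
        exact hx (Fin.castSucc_le_succ k)
    · intro k
      cases k using Fin.cases with
      | zero => simp [hx0, hft i]
      | succ k =>
        rw [← Fin.succ_castSucc, Fin.cons_succ, Fin.cons_succ, Fin.cons_succ]
        exact hval k

/-- The distribution function of an atomless probability measure is continuous. -/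
theorem continuous_cdf (μ : Measure ℝ) [IsProbabilityMeasure μ] [NullSingletonClass μ] :
    Continuous (ProbabilityTheory.cdf μ) := by
  rw [continuous_iff_continuousAt]
  intro x
  have hmono := ProbabilityTheory.monotone_cdf μ
  rw [hmono.continuousAt_iff_leftLim_eq_rightLim, StieltjesFunction.rightLim_eq]
  have h := (ProbabilityTheory.cdf μ).measure_singleton x
  rw [ProbabilityTheory.measure_cdf, measure_singleton, eq_comm, ENNReal.ofReal_eq_zero] at h
  exact le_antisymm (hmono.leftLim_le le_rfl) (by linarith)

/-- An atomless probability measure of a closed interval is the increment of its distribution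
function. -/
theorem measure_Icc_eq_ofReal_cdf_sub (μ : Measure ℝ) [IsProbabilityMeasure μ] [NullSingletonClass μ]
    (a b : ℝ) :
    μ (Set.Icc a b) = ENNReal.ofReal (ProbabilityTheory.cdf μ b - ProbabilityTheory.cdf μ a) := by
  rw [← measure_congr Ioc_ae_eq_Icc, ← StieltjesFunction.measure_Ioc,
    ProbabilityTheory.measure_cdf]

/-- The Last Diminisher mechanism produces a proportional allocation of contiguous slices:
there exist cut points `0 = x 0 ≤ x 1 ≤ ... ≤ x n = 1` and a permutation `σ` of the agents
such that agent `σ k` values the `k`-th slice at least `1/n`. -/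
theorem last_diminisher_proportional {n : ℕ} (hn : 0 < n)
    (u : Fin n → Measure ℝ)
    (hprob : ∀ i, IsProbabilityMeasure (u i))
    (hfull : ∀ i, u i (Set.Icc 0 1) = 1)
    (hatom : ∀ i (x : ℝ), u i {x} = 0) :
    ∃ (x : Fin (n+1) → ℝ) (σ : Equiv.Perm (Fin n)),
      x 0 = 0 ∧ x (Fin.last n) = 1 ∧ Monotone x ∧
      ∀ k : Fin n, (n : ℝ≥0∞)⁻¹ ≤ u (σ k) (Set.Icc (x k.castSucc) (x k.succ)) := by
  obtain ⟨m, rfl⟩ := Nat.exists_eq_add_one.mpr hn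
  have hna : ∀ i, NullSingletonClass (u i) := fun i => ⟨hatom i⟩
  have hm : (0 : ℝ) < m + 1 := by positivity
  obtain ⟨x, σ, hσ, hx0, hx1, hx, hval⟩ := exists_cuts_of_continuous_monotone
    (c := ((m : ℝ) + 1)⁻¹) (by positivity) m 0 zero_le_one
    (fun i => ProbabilityTheory.cdf (u i)) (fun i => ProbabilityTheory.monotone_cdf _)
    (fun i => continuous_cdf _) (fun i => by
      have h := hfull i
      rw [measure_Icc_eq_ofReal_cdf_sub, ENNReal.ofReal_eq_one] at h
      rw [h, mul_inv_cancel₀ hm.ne'])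
  refine ⟨x, Equiv.ofBijective σ hσ.bijective_of_finite, hx0, hx1, hx, fun k => ?_⟩
  rw [Equiv.ofBijective_apply, measure_Icc_eq_ofReal_cdf_sub]
  calc ((m + 1 : ℕ) : ℝ≥0∞)⁻¹ = ENNReal.ofReal ((m : ℝ) + 1)⁻¹ := by
        rw [ENNReal.ofReal_inv_of_pos hm, ← Nat.cast_add_one, ENNReal.ofReal_natCast]
    _ ≤ _ := ENNReal.ofReal_le_ofReal (hval k)
end

section
/- A necessary and sufficient condition for the existence of a utilitarian optimal allocation is that the cake can be divided into a finite number of slices each dominated by a single agent. Precisely: among allocations whose portions are finite unions of closed intervals, an allocation maximizing UE exists if and only if there exist cut points 0 = x_0 < x_1 < ... < x_m = 1 such that for every l ∈ {1,...,m} there is an agent j with the property that for every subinterval S' ⊆ [x_{l-1}, x_l] and every agent k, u_j(S') ≥ u_k(S'). -/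
open MeasureTheory

/-- A finite union of closed intervals. -/
def FinUnionIcc (A : Set ℝ) : Prop :=
  ∃ (m : ℕ) (a b : Fin m → ℝ), A = ⋃ k, Set.Icc (a k) (b k)

/-- An allocation whose portions are finite unions of closed intervals inside `[0,1]`,
pairwise disjoint up to boundary points (null overlap). -/
def IsFUAllocation {n : ℕ} (A : Fin n → Set ℝ) : Prop :=
  (∀ i, A i ⊆ Set.Icc 0 1) ∧ (∀ i, FinUnionIcc (A i)) ∧
    ∀ i j, i ≠ j → volume (A i ∩ A j) = 0

open Set

theorem FinUnionIcc.of_finite {ι : Type*} [Finite ι] (a b : ι → ℝ) :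
    FinUnionIcc (⋃ k, Icc (a k) (b k)) := by
  obtain ⟨m, ⟨e⟩⟩ := Finite.exists_equiv_fin ι
  exact ⟨m, a ∘ e.symm, b ∘ e.symm,
    (e.symm.surjective.iUnion_comp fun k => Icc (a k) (b k)).symm⟩

theorem finUnionIcc_Icc (a b : ℝ) : FinUnionIcc (Icc a b) := by
  rw [← iUnion_const (ι := Unit) (Icc a b)]
  exact FinUnionIcc.of_finite (fun _ => a) fun _ => b

theorem FinUnionIcc.union {A B : Set ℝ} (hA : FinUnionIcc A) (hB : FinUnionIcc B) :
    FinUnionIcc (A ∪ B) := by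
  obtain ⟨m, a, b, rfl⟩ := hA
  obtain ⟨p, c, d, rfl⟩ := hB
  simpa [iUnion_sum] using FinUnionIcc.of_finite (Sum.elim a c) (Sum.elim b d)

theorem FinUnionIcc.diff_Ioo {A : Set ℝ} (hA : FinUnionIcc A) (p q : ℝ) :
    FinUnionIcc (A \ Ioo p q) := by
  obtain ⟨m, a, b, rfl⟩ := hA
  have h : (⋃ k, Icc (a k) (b k)) \ Ioo p q =
      (⋃ k, Icc (a k) (min (b k) p)) ∪ ⋃ k, Icc (max (a k) q) (b k) := by
    rw [iUnion_sdiff, ← iUnion_union_distrib]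
    refine iUnion_congr fun k => ?_
    ext y
    simp only [mem_sdiff, mem_union, mem_Icc, mem_Ioo, le_min_iff, max_le_iff]
    grind
  rw [h]
  exact (FinUnionIcc.of_finite _ _).union (FinUnionIcc.of_finite _ _)

theorem FinUnionIcc.measurableSet {A : Set ℝ} (hA : FinUnionIcc A) : MeasurableSet A := by
  obtain ⟨m, a, b, rfl⟩ := hA
  exact MeasurableSet.iUnion fun _ => measurableSet_Icc

/-- Comparison of integrals over all subintervals gives an almost everywhere comparison. -/
theorem ae_le_of_forall_setIntegral_Icc_le {f g : ℝ → ℝ} {p q : ℝ} (hpq : p ≤ q)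
    (hf : IntegrableOn f (Icc p q)) (hg : IntegrableOn g (Icc p q))
    (h : ∀ a b, p ≤ a → a ≤ b → b ≤ q → ∫ y in Icc a b, f y ≤ ∫ y in Icc a b, g y) :
    ∀ᵐ x, x ∈ Icc p q → f x ≤ g x := by
  have hf' : IntervalIntegrable f volume p q := by
    rwa [intervalIntegrable_iff_integrableOn_Icc_of_le hpq]
  have hg' : IntervalIntegrable g volume p q := by
    rwa [intervalIntegrable_iff_integrableOn_Icc_of_le hpq]
  have hgf := hg'.sub hf'
  have hmono : MonotoneOn (fun x => ∫ y in p..x, g y - f y) (Icc p q) := by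
    intro a ha b hb hab
    have hsub : ∀ {u v}, u ∈ Icc p q → v ∈ Icc p q →
        IntervalIntegrable f volume u v ∧ IntervalIntegrable g volume u v := by
      intro u v hu hv
      have : uIcc u v ⊆ uIcc p q := by
        rw [uIcc_of_le hpq]
        exact uIcc_subset_Icc hu hv
      exact ⟨hf'.mono_set this, hg'.mono_set this⟩
    have hp : p ∈ Icc p q := left_mem_Icc.2 hpq
    have key : 0 ≤ ∫ y in a..b, g y - f y := by
      rw [intervalIntegral.integral_sub (hsub ha hb).2 (hsub ha hb).1,
        intervalIntegral.integral_of_le hab, intervalIntegral.integral_of_le hab,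
        ← integral_Icc_eq_integral_Ioc, ← integral_Icc_eq_integral_Ioc]
      linarith [h a b ha.1 hab hb.2]
    have hadd := intervalIntegral.integral_add_adjacent_intervals
      ((hsub hp ha).2.sub (hsub hp ha).1) ((hsub ha hb).2.sub (hsub ha hb).1)
    show ∫ y in p..a, g y - f y ≤ ∫ y in p..b, g y - f y
    linarith
  have hne : ∀ c : ℝ, ∀ᵐ x, x ≠ c := fun c => by simp [ae_iff, measure_singleton]
  filter_upwards [hgf.ae_hasDerivAt_integral, hne p, hne q] with x hx hxp hxq hmem
  have hmem' : x ∈ Ioo p q := ⟨lt_of_le_of_ne hmem.1 hxp.symm, lt_of_le_of_ne hmem.2 hxq⟩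
  rw [uIcc_of_le hpq] at hx
  have hd := hx hmem p (left_mem_Icc.2 hpq)
  have h0 := hmono.derivWithin_nonneg (x := x)
  rw [derivWithin_of_mem_nhds (Icc_mem_nhds hmem'.1 hmem'.2), hd.deriv] at h0
  simpa using h0

theorem exists_mem_Icc_castSucc_succ {m : ℕ} (hm : 0 < m) {x : Fin (m + 1) → ℝ}
    (hx : StrictMono x) {y : ℝ} (h0 : x 0 ≤ y) (h1 : y ≤ x (Fin.last m)) :
    ∃ l : Fin m, y ∈ Icc (x l.castSucc) (x l.succ) := by
  have key : ∀ i : Fin (m + 1), y ≤ x i →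
      y = x 0 ∨ ∃ l : Fin m, y ∈ Icc (x l.castSucc) (x l.succ) := by
    intro i
    induction i using Fin.induction with
    | zero => exact fun h => Or.inl (le_antisymm h h0)
    | succ i ih =>
      intro h
      rcases le_total y (x i.castSucc) with h' | h'
      · exact ih h'
      · exact Or.inr ⟨i, h', h⟩
  rcases key _ h1 with h | h
  · exact ⟨⟨0, hm⟩, h0, h.le.trans (hx.monotone (Fin.zero_le _))⟩
  · exact h

theorem volume_Icc_inter_Icc_eq_zero_of_ne {m : ℕ} {x : Fin (m + 1) → ℝ}
    (hx : StrictMono x) {l l' : Fin m} (hl : l ≠ l') :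
    volume (Icc (x l.castSucc) (x l.succ) ∩ Icc (x l'.castSucc) (x l'.succ)) = 0 := by
  wlog h : l < l' generalizing l l'
  · rw [inter_comm]
    exact this hl.symm (lt_of_le_of_ne (not_lt.1 h) hl.symm)
  have h' : x l.succ ≤ x l'.castSucc := hx.monotone (by
    rw [Fin.le_def]
    simpa using h)
  refine measure_mono_null (t := {x l.succ}) ?_ (measure_singleton _)
  rintro y ⟨⟨_, h2⟩, h3, _⟩
  exact le_antisymm h2 (h'.trans h3)

/-- A finite set containing `0` and `1` and contained in `[0,1]` yields cut points whose
open slices avoid the set. -/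
theorem exists_strictMono_cut_points (S : Finset ℝ) (hS : ↑S ⊆ Icc (0 : ℝ) 1)
    (h0 : (0 : ℝ) ∈ S) (h1 : (1 : ℝ) ∈ S) :
    ∃ (m : ℕ) (x : Fin (m + 1) → ℝ), 0 < m ∧ x 0 = 0 ∧ x (Fin.last m) = 1 ∧ StrictMono x ∧
      ∀ l : Fin m, ∀ s ∈ S, s ∉ Ioo (x l.castSucc) (x l.succ) := by
  have hcard : 1 < S.card := Finset.one_lt_card.2 ⟨0, h0, 1, h1, zero_ne_one⟩
  obtain ⟨m, hm⟩ : ∃ m, S.card = m + 1 := ⟨S.card - 1, by omega⟩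
  have hmono := (S.orderEmbOfFin hm).strictMono
  have hmem : ∀ i, S.orderEmbOfFin hm i ∈ Icc (0 : ℝ) 1 := fun i =>
    hS (S.orderEmbOfFin_mem hm i)
  have hsurj : ∀ s ∈ S, ∃ i, S.orderEmbOfFin hm i = s := fun s hs => by
    have : s ∈ range (S.orderEmbOfFin hm) := by
      rw [Finset.range_orderEmbOfFin]
      exact hs
    exact this
  refine ⟨m, S.orderEmbOfFin hm, by omega, ?_, ?_, hmono, ?_⟩
  · obtain ⟨i, hi⟩ := hsurj 0 h0
    exact le_antisymm ((hmono.monotone (Fin.zero_le i)).trans hi.le) (hmem 0).1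
  · obtain ⟨i, hi⟩ := hsurj 1 h1
    exact le_antisymm (hmem _).2 (hi.ge.trans (hmono.monotone (Fin.le_last i)))
  · intro l s hs hmem
    obtain ⟨i, rfl⟩ := hsurj s hs
    have h2 := hmono.lt_iff_lt.1 hmem.1
    have h3 := hmono.lt_iff_lt.1 hmem.2
    rw [Fin.lt_def] at h2 h3
    simp at h2 h3
    omega

/-- An optimal allocation extracts at least every agent's value from each subinterval. -/
theorem setIntegral_Icc_le_sum_of_optimal {n : ℕ} {t : Fin n → ℝ → ℝ}
    (hint : ∀ i, IntegrableOn (t i) (Icc 0 1)) {A : Fin n → Set ℝ} (hA : IsFUAllocation A)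
    (hopt : ∀ B : Fin n → Set ℝ, IsFUAllocation B →
      ∑ i, ∫ x in B i, t i x ≤ ∑ i, ∫ x in A i, t i x)
    {a b : ℝ} (ha : 0 ≤ a) (hb : b ≤ 1) (k : Fin n) :
    ∫ y in Icc a b, t k y ≤ ∑ i, ∫ y in A i ∩ Icc a b, t i y := by
  obtain ⟨hsub, hfu, hdisj⟩ := hA
  have hI : Icc a b ⊆ Icc (0 : ℝ) 1 := Icc_subset_Icc ha hb
  let B : Fin n → Set ℝ := fun i => if i = k then A i ∪ Icc a b else A i \ Ioo a b
  have hnull : ∀ i, i ≠ k → volume ((A i \ Ioo a b) ∩ (A k ∪ Icc a b)) = 0 := by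
    intro i hi
    refine measure_mono_null (t := A i ∩ A k ∪ {a, b}) ?_
      (measure_union_null (hdisj i k hi) ((toFinite {a, b}).measure_zero _))
    rintro y ⟨⟨h1, h2⟩, h3 | h3⟩
    · exact Or.inl ⟨h1, h3⟩
    · right
      simp only [mem_Ioo, mem_Icc, mem_insert_iff, mem_singleton_iff] at *
      grind
  have hB : IsFUAllocation B := by
    refine ⟨fun i => ?_, fun i => ?_, fun i j hij => ?_⟩
    · by_cases h : i = k
      · simpa [B, h] using ⟨hsub k, hI⟩
      · simpa only [B, h, if_false] using sdiff_subset.trans (hsub i)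
    · by_cases h : i = k
      · simpa only [B, h, if_true] using (hfu k).union (finUnionIcc_Icc a b)
      · simpa only [B, h, if_false] using (hfu i).diff_Ioo a b
    · by_cases h : i = k
      · have hj : j ≠ k := fun hj => hij (h.trans hj.symm)
        subst h
        simp only [B, hj, if_true, if_false]
        rw [inter_comm]
        exact hnull j hj
      · by_cases h' : j = k
        · subst h'
          simpa only [B, h, if_true, if_false] using hnull i h
        · simp only [B, h, h', if_false]
          exact measure_mono_null (inter_subset_inter sdiff_subset sdiff_subset) (hdisj i j hij)
  have hsplit : ∀ i, ∫ y in A i, t i y =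
      (∫ y in A i ∩ Icc a b, t i y) + ∫ y in A i \ Icc a b, t i y := fun i =>
    (integral_inter_add_sdiff measurableSet_Icc ((hint i).mono_set (hsub i))).symm
  have hBi : ∀ i, ∫ y in B i, t i y =
      (∫ y in A i \ Icc a b, t i y) + if i = k then ∫ y in Icc a b, t k y else 0 := by
    intro i
    by_cases h : i = k
    · subst h
      simp only [B, if_true]
      rw [← sdiff_union_self, setIntegral_union disjoint_sdiff_left measurableSet_Icc
        ((hint i).mono_set (sdiff_subset.trans (hsub i))) ((hint i).mono_set hI)]
    · simp only [B, h, if_false, add_zero]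
      exact setIntegral_congr_set ((ae_eq_refl _).diff Ioo_ae_eq_Icc)
  have := hopt B hB
  simp only [hBi, hsplit, Finset.sum_add_distrib, Finset.sum_ite_eq', Finset.mem_univ,
    if_true] at this
  linarith

theorem exists_cut_points_of_optimal {n : ℕ} (hn : 0 < n) {t : Fin n → ℝ → ℝ}
    (ht0 : ∀ i x, 0 ≤ t i x) (hint : ∀ i, IntegrableOn (t i) (Icc 0 1))
    {A : Fin n → Set ℝ} (hA : IsFUAllocation A)
    (hopt : ∀ B : Fin n → Set ℝ, IsFUAllocation B →
      ∑ i, ∫ x in B i, t i x ≤ ∑ i, ∫ x in A i, t i x) :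
    ∃ (m : ℕ) (x : Fin (m+1) → ℝ), 0 < m ∧ x 0 = 0 ∧ x (Fin.last m) = 1 ∧
      StrictMono x ∧
      ∀ l : Fin m, ∃ j : Fin n, ∀ a b : ℝ,
        x l.castSucc ≤ a → a ≤ b → b ≤ x l.succ →
          ∀ k : Fin n, ∫ y in Icc a b, t k y ≤ ∫ y in Icc a b, t j y := by
  classical
  have hkey := fun {a b : ℝ} => setIntegral_Icc_le_sum_of_optimal (a := a) (b := b) hint hA hopt
  obtain ⟨-, hfu, hdisj⟩ := hA
  choose M c d hcd using hfu
  let T : Finset ℝ := insert 0 (insert 1 (Finset.univ.biUnion fun i =>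
    Finset.univ.image (c i) ∪ Finset.univ.image (d i)))
  obtain ⟨m, x, hm, hx0, hx1, hx, hav⟩ := exists_strictMono_cut_points
    (T.filter (· ∈ Icc (0 : ℝ) 1)) (fun y hy => (Finset.mem_filter.1 hy).2)
    (by simp [T]) (by simp [T])
  refine ⟨m, x, hm, hx0, hx1, hx, fun l => ?_⟩
  have hl0 : 0 ≤ x l.castSucc := hx0 ▸ hx.monotone (Fin.zero_le _)
  have hl1 : x l.succ ≤ 1 := hx1 ▸ hx.monotone (Fin.le_last _)
  have hT : ∀ s ∈ T, s ∉ Ioo (x l.castSucc) (x l.succ) := fun s hs hmem =>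
    hav l s (Finset.mem_filter.2 ⟨hs, hl0.trans hmem.1.le, hmem.2.le.trans hl1⟩) hmem
  have hcases : ∀ i, Icc (x l.castSucc) (x l.succ) ⊆ A i ∨
      Disjoint (A i) (Ioo (x l.castSucc) (x l.succ)) := by
    intro i
    rw [or_iff_not_imp_right, not_disjoint_iff]
    rintro ⟨y, hyA, hy⟩
    rw [hcd i] at hyA ⊢
    obtain ⟨r, hr⟩ := mem_iUnion.1 hyA
    have hc := hT (c i r) (by
      simp only [T, Finset.mem_insert, Finset.mem_biUnion, Finset.mem_union, Finset.mem_image]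
      exact Or.inr (Or.inr ⟨i, Finset.mem_univ i, Or.inl ⟨r, Finset.mem_univ r, rfl⟩⟩))
    have hd := hT (d i r) (by
      simp only [T, Finset.mem_insert, Finset.mem_biUnion, Finset.mem_union, Finset.mem_image]
      exact Or.inr (Or.inr ⟨i, Finset.mem_univ i, Or.inr ⟨r, Finset.mem_univ r, rfl⟩⟩))
    refine (Icc_subset_Icc ?_ ?_).trans (subset_iUnion (fun k => Icc (c i k) (d i k)) r)
    · by_contra! h
      exact hc ⟨h, hr.1.trans_lt hy.2⟩
    · by_contra! h
      exact hd ⟨hy.1.trans_le hr.2, h⟩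
  by_cases hex : ∃ j, Icc (x l.castSucc) (x l.succ) ⊆ A j
  · obtain ⟨j, hj⟩ := hex
    refine ⟨j, fun a b ha _ hb k => (hkey (hl0.trans ha) (hb.trans hl1) k).trans ?_⟩
    have hab : Icc a b ⊆ A j := (Icc_subset_Icc ha hb).trans hj
    rw [Finset.sum_eq_single j, inter_eq_right.2 hab]
    · intro i _ hij
      exact setIntegral_measure_zero _
        (measure_mono_null (inter_subset_inter_right _ hab) (hdisj i j hij))
    · simp
  · push Not at hex
    refine ⟨⟨0, hn⟩, fun a b ha _ hb k => (hkey (hl0.trans ha) (hb.trans hl1) k).trans ?_⟩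
    rw [Finset.sum_eq_zero]
    · exact integral_nonneg fun y => ht0 _ y
    · intro i _
      refine setIntegral_measure_zero _ (measure_mono_null (t := {a, b}) ?_
        ((toFinite {a, b}).measure_zero _))
      rintro y ⟨hyA, hy⟩
      have := disjoint_left.1 ((hcases i).resolve_left (hex i)) hyA
      simp only [mem_Ioo, mem_Icc, mem_insert_iff, mem_singleton_iff] at *
      grind

theorem exists_optimal_of_cut_points {n : ℕ} {t : Fin n → ℝ → ℝ}
    (ht0 : ∀ i x, 0 ≤ t i x) (hint : ∀ i, IntegrableOn (t i) (Icc 0 1))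
    {m : ℕ} {x : Fin (m + 1) → ℝ} (hm : 0 < m) (hx0 : x 0 = 0) (hx1 : x (Fin.last m) = 1)
    (hx : StrictMono x) {j : Fin m → Fin n}
    (hj : ∀ l a b, x l.castSucc ≤ a → a ≤ b → b ≤ x l.succ →
      ∀ k : Fin n, ∫ y in Icc a b, t k y ≤ ∫ y in Icc a b, t (j l) y) :
    ∃ A : Fin n → Set ℝ, IsFUAllocation A ∧
      ∀ B : Fin n → Set ℝ, IsFUAllocation B →
        ∑ i, ∫ x in B i, t i x ≤ ∑ i, ∫ x in A i, t i x := by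
  classical
  let I : Fin m → Set ℝ := fun l => Icc (x l.castSucc) (x l.succ)
  have hI : ∀ l, I l ⊆ Icc (0 : ℝ) 1 := fun l =>
    Icc_subset_Icc (hx0 ▸ hx.monotone (Fin.zero_le _)) (hx1 ▸ hx.monotone (Fin.le_last _))
  have hIm : ∀ l, MeasurableSet (I l) := fun _ => measurableSet_Icc
  have hId : ∀ {l l'}, l ≠ l' → volume (I l ∩ I l') = 0 := fun h =>
    volume_Icc_inter_Icc_eq_zero_of_ne hx h
  have hae : ∀ l k, ∀ᵐ y, y ∈ I l → t k y ≤ t (j l) y := fun l k =>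
    ae_le_of_forall_setIntegral_Icc_le (hx.monotone (Fin.castSucc_lt_succ (i := l)).le)
      ((hint k).mono_set (hI l)) ((hint (j l)).mono_set (hI l))
      fun a b ha hab hb => hj l a b ha hab hb k
  let A : Fin n → Set ℝ := fun i => ⋃ l : {l // j l = i}, I l
  have hAsub : ∀ i, A i ⊆ Icc 0 1 := fun i => iUnion_subset fun l => hI l
  refine ⟨A, ⟨hAsub, fun i => FinUnionIcc.of_finite _ _, ?_⟩, ?_⟩
  · intro i i' hii
    simp only [A, iUnion_inter, inter_iUnion]
    refine measure_iUnion_null fun l => measure_iUnion_null fun l' => hId fun h => hii ?_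
    rw [← l.2, ← l'.2, h]
  · rintro B ⟨hsub, hfu, hdisj⟩
    have hAint : ∀ i, ∫ y in A i, t i y = ∑ l : {l // j l = i}, ∫ y in I l, t (j l) y := by
      intro i
      rw [integral_iUnion_ae (s := fun l : {l // j l = i} => I l)
        (fun l => (hIm l).nullMeasurableSet)
        (fun l l' h => hId (Subtype.coe_injective.ne h)) ((hint i).mono_set (hAsub i)),
        tsum_fintype]
      exact Finset.sum_congr rfl fun l _ => by rw [l.2]
    have hBint : ∀ i, ∫ y in B i, t i y = ∑ l, ∫ y in B i ∩ I l, t i y := by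
      intro i
      have hcov : B i = ⋃ l, B i ∩ I l := by
        rw [← inter_iUnion, eq_comm, inter_eq_left]
        intro y hy
        exact mem_iUnion.2 (exists_mem_Icc_castSucc_succ hm hx (hx0 ▸ (hsub i hy).1)
          (hx1 ▸ (hsub i hy).2))
      conv_lhs => rw [hcov]
      rw [integral_iUnion_ae
        (fun l => ((hfu i).measurableSet.inter (hIm l)).nullMeasurableSet)
        (fun l l' h => measure_mono_null
          (inter_subset_inter inter_subset_right inter_subset_right) (hId h))
        ((hint i).mono_set (hcov ▸ hsub i)), tsum_fintype]
    calc ∑ i, ∫ y in B i, t i y = ∑ l, ∑ i, ∫ y in B i ∩ I l, t i y := by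
          simp only [hBint]
          exact Finset.sum_comm
      _ ≤ ∑ l, ∫ y in I l, t (j l) y := by
          refine Finset.sum_le_sum fun l _ => ?_
          have hBI : (⋃ i, B i ∩ I l) ⊆ I l := iUnion_subset fun i => inter_subset_right
          calc ∑ i, ∫ y in B i ∩ I l, t i y ≤ ∑ i, ∫ y in B i ∩ I l, t (j l) y := by
                refine Finset.sum_le_sum fun i _ => ?_
                refine setIntegral_mono_on_ae
                  ((hint i).mono_set (inter_subset_left.trans (hsub i)))
                  ((hint (j l)).mono_set (inter_subset_left.trans (hsub i)))
                  ((hfu i).measurableSet.inter (hIm l)) ?_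
                filter_upwards [hae l i] with y hy hmem using hy hmem.2
            _ = ∫ y in ⋃ i, B i ∩ I l, t (j l) y := by
                rw [integral_iUnion_ae
                  (fun i => ((hfu i).measurableSet.inter (hIm l)).nullMeasurableSet)
                  (fun i i' h => measure_mono_null
                    (inter_subset_inter inter_subset_left inter_subset_left) (hdisj i i' h))
                  ((hint (j l)).mono_set (hBI.trans (hI l))), tsum_fintype]
            _ ≤ ∫ y in I l, t (j l) y :=
                setIntegral_mono_set ((hint (j l)).mono_set (hI l))
                  (ae_of_all _ fun y => ht0 _ y) hBI.eventuallyLE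
      _ = ∑ i, ∫ y in A i, t i y := by
          simp only [hAint]
          exact (Fintype.sum_fiberwise j _).symm

/-- A utilitarian optimal allocation (among allocations of finite unions of closed intervals)
exists if and only if the cake can be divided into finitely many slices, each of which is
dominated by a single agent on every subinterval. -/
theorem utilitarian_optimum_exists_iff {n : ℕ} (hn : 0 < n)
    (t : Fin n → ℝ → ℝ)
    (ht0 : ∀ i x, 0 ≤ t i x)
    (hint : ∀ i, IntegrableOn (t i) (Set.Icc 0 1))
    (hone : ∀ i, ∫ x in Set.Icc (0:ℝ) 1, t i x = 1) :
    (∃ A : Fin n → Set ℝ, IsFUAllocation A ∧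
      ∀ B : Fin n → Set ℝ, IsFUAllocation B →
        ∑ i, ∫ x in B i, t i x ≤ ∑ i, ∫ x in A i, t i x) ↔
    (∃ (m : ℕ) (x : Fin (m+1) → ℝ), 0 < m ∧ x 0 = 0 ∧ x (Fin.last m) = 1 ∧
      StrictMono x ∧
      ∀ l : Fin m, ∃ j : Fin n, ∀ a b : ℝ,
        x l.castSucc ≤ a → a ≤ b → b ≤ x l.succ →
          ∀ k : Fin n, ∫ y in Set.Icc a b, t k y ≤ ∫ y in Set.Icc a b, t j y) := by
  constructor
  · rintro ⟨A, hA, hopt⟩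
    exact exists_cut_points_of_optimal hn ht0 hint hA hopt
  · rintro ⟨m, x, hm, hx0, hx1, hx, h⟩
    choose j hj using h
    exact exists_optimal_of_cut_points ht0 hint hm hx0 hx1 hx hj
end

section
/- The price of proportionality with respect to utilitarian efficiency is at least √n/2: for every integer m ≥ 2 and n = m², there is a piecewise uniform cake cutting situation with n agents — agent i for i ∈ {1,...,m} values exactly [(i-1)/m, i/m], and every other agent values the entire cake [0,1] — in which some allocation has utilitarian efficiency √n, while every proportional allocation has utilitarian efficiency at most 2. -/
open MeasureTheory

/-- An allocation: an `n`-tuple of pairwise disjoint measurable subsets of the cake `[0,1]`. -/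
def IsAllocation {n : ℕ} (A : Fin n → Set ℝ) : Prop :=
  (∀ i, A i ⊆ Set.Icc 0 1) ∧ (∀ i, MeasurableSet (A i)) ∧
    ∀ i j, i ≠ j → Disjoint (A i) (A j)

/-- Piecewise uniform utility: `u_P(X) = |X ∩ P| / |P|`. -/
noncomputable def pwUtil (P X : Set ℝ) : ℝ :=
  (volume (X ∩ P)).toReal / (volume P).toReal

/-- A sum over `Fin n` of a function with one value below `m` and another value from `m` on. -/
theorem Fin.sum_ite_val_lt {n m : ℕ} (h : m ≤ n) (c d : ℝ) :
    ∑ i : Fin n, (if (i : ℕ) < m then c else d) = m * c + ((n : ℝ) - m) * d := by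
  obtain ⟨k, rfl⟩ := Nat.exists_eq_add_of_le h
  simp [Fin.sum_univ_add]

/-- The pieces of an allocation have total length at most `1`. -/
theorem IsAllocation.sum_volume_le_one {n : ℕ} {A : Fin n → Set ℝ} (hA : IsAllocation A) :
    ∑ i, volume.real (A i) ≤ 1 := by
  obtain ⟨hsub, hmeas, hdisj⟩ := hA
  have hfin : ∀ i, volume (A i) ≠ ⊤ := fun i =>
    measure_ne_top_of_subset (hsub i) (by simp)
  have h : volume.real (⋃ i, A i) = ∑ i, volume.real (A i) :=
    measureReal_iUnion_fintype (fun i j hij => hdisj i j hij) hmeas hfin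
  rw [← h]
  calc volume.real (⋃ i, A i) ≤ volume.real (Set.Icc (0 : ℝ) 1) :=
        measureReal_mono (Set.iUnion_subset hsub) (by simp)
    _ = 1 := by simp

theorem volume_real_Icc_div {m : ℕ} (k : ℕ) :
    (volume (Set.Icc ((k : ℝ) / m) (((k : ℝ) + 1) / m))).toReal = 1 / m := by
  have h : ((k : ℝ) + 1) / m - k / m = 1 / m := by ring
  rw [Real.volume_Icc, h, ENNReal.toReal_ofReal (by positivity)]

/-- Half-open pieces of length `1 / m`, one for each of the first `m` agents. -/
theorem isAllocation_Ico_div {n m : ℕ} (hm : 0 < m) :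
    IsAllocation fun i : Fin n =>
      if (i : ℕ) < m then Set.Ico (((i : ℕ) : ℝ) / m) ((((i : ℕ) : ℝ) + 1) / m) else ∅ := by
  have hm' : (0 : ℝ) < m := by exact_mod_cast hm
  refine ⟨fun i => ?_, fun i => ?_, fun i j hij => ?_⟩
  · dsimp only
    split_ifs with hi
    · have hi' : ((i : ℕ) : ℝ) + 1 ≤ m := by exact_mod_cast hi
      exact Set.Ico_subset_Icc_self.trans
        (Set.Icc_subset_Icc (by positivity) ((div_le_one hm').2 hi'))
    · exact Set.empty_subset _
  · dsimp only
    split_ifs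
    · exact measurableSet_Ico
    · exact MeasurableSet.empty
  · dsimp only
    split_ifs
    · rw [Set.disjoint_left]
      rintro x ⟨h1, h2⟩ ⟨h3, h4⟩
      rw [div_le_iff₀ hm'] at h1 h3
      rw [lt_div_iff₀ hm'] at h2 h4
      have h5 : (i : ℕ) < j + 1 := by exact_mod_cast h1.trans_lt h4
      have h6 : (j : ℕ) < i + 1 := by exact_mod_cast h3.trans_lt h2
      exact hij (Fin.ext (by omega))
    all_goals simp

/-- The price of proportionality is at least `√n / 2`: with `n = m²` agents, where agent
`i < m` values exactly `[i/m, (i+1)/m]` and all other agents value all of `[0,1]`, some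
allocation has utilitarian efficiency `√n` while every proportional allocation has
utilitarian efficiency at most `2`. -/
theorem price_of_proportionality (m : ℕ) (hm : 2 ≤ m)
    (P : Fin (m^2) → Set ℝ)
    (hP : ∀ i : Fin (m^2),
      ((i : ℕ) < m → P i = Set.Icc (((i : ℕ) : ℝ)/m) ((((i : ℕ) : ℝ) + 1)/m)) ∧
      (m ≤ (i : ℕ) → P i = Set.Icc 0 1)) :
    (∃ A : Fin (m^2) → Set ℝ, IsAllocation A ∧
      ∑ i, pwUtil (P i) (A i) = Real.sqrt ((m : ℝ)^2)) ∧
    (∀ A : Fin (m^2) → Set ℝ, IsAllocation A →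
      (∀ i, 1 / ((m : ℝ)^2) ≤ pwUtil (P i) (A i)) →
      ∑ i, pwUtil (P i) (A i) ≤ 2) := by
  have hm0 : (0 : ℝ) < m := by positivity
  have hm1 : (1 : ℝ) ≤ m := by exact_mod_cast one_le_two.trans hm
  have hmn : m ≤ m ^ 2 := Nat.le_self_pow two_ne_zero m
  refine ⟨⟨_, isAllocation_Ico_div (by omega : 0 < m), ?_⟩, fun A hA hprop => ?_⟩
  · have hu : ∀ i : Fin (m ^ 2), pwUtil (P i)
        (if (i : ℕ) < m then Set.Ico (((i : ℕ) : ℝ) / m) ((((i : ℕ) : ℝ) + 1) / m) else ∅) =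
        if (i : ℕ) < m then 1 else 0 := by
      intro i
      unfold pwUtil
      split_ifs with hi
      · rw [(hP i).1 hi, Set.inter_eq_left.2 Set.Ico_subset_Icc_self, Real.volume_Ico,
          ← Real.volume_Icc, volume_real_Icc_div, div_self (by positivity)]
      · simp
    rw [Finset.sum_congr rfl fun i _ => hu i, Fin.sum_ite_val_lt hmn, Real.sqrt_sq hm0.le]
    ring
  · have hu : ∀ i, pwUtil (P i) (A i) ≤ m * volume.real (A i) -
        if (i : ℕ) < m then 0 else ((m : ℝ) - 1) * (1 / (m : ℝ) ^ 2) := by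
      intro i
      have hp := hprop i
      unfold pwUtil at hp ⊢
      split_ifs with hi
      · have hle : volume.real (A i ∩ P i) ≤ volume.real (A i) :=
          measureReal_mono Set.inter_subset_left
            (measure_ne_top_of_subset (hA.1 i) (by simp))
        rw [(hP i).1 hi] at hle ⊢
        rw [volume_real_Icc_div, div_div_eq_mul_div, div_one, sub_zero, mul_comm]
        exact mul_le_mul_of_nonneg_left hle hm0.le
      · rw [(hP i).2 (not_lt.1 hi), Set.inter_eq_left.2 (hA.1 i)] at hp ⊢
        simp only [Real.volume_Icc, sub_zero, ENNReal.ofReal_one, ENNReal.toReal_one,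
          div_one] at hp ⊢
        have := mul_le_mul_of_nonneg_left hp (sub_nonneg.2 hm1)
        change _ ≤ m * (volume (A i)).toReal - _
        linarith
    calc ∑ i, pwUtil (P i) (A i)
        ≤ m * ∑ i, volume.real (A i) -
          ((m : ℝ) ^ 2 - m) * (((m : ℝ) - 1) * (1 / (m : ℝ) ^ 2)) := by
          refine (Finset.sum_le_sum fun i _ => hu i).trans_eq ?_
          rw [Finset.sum_sub_distrib, Fin.sum_ite_val_lt hmn, Finset.mul_sum]
          push_cast
          ring
      _ ≤ m * 1 - ((m : ℝ) ^ 2 - m) * (((m : ℝ) - 1) * (1 / (m : ℝ) ^ 2)) := by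
          gcongr
          exact hA.sum_volume_le_one
      _ = 2 - 1 / m := by
          field_simp
          ring
      _ ≤ 2 := sub_le_self _ (by positivity)
end

section
/- With sincere agents, the Length Game produces a utilitarian optimal allocation: given a piecewise uniform cake cutting situation (P_1,...,P_n), order the agents by i ≺ j iff |P_i| < |P_j|, or |P_i| = |P_j| and i < j, and let A_i = P_i \ ⋃_{j ≺ i} P_j. Then for every allocation B (any n-tuple of pairwise disjoint measurable subsets of [0,1]), Σ_{i=1}^n |B_i ∩ P_i|/|P_i| ≤ Σ_{i=1}^n |A_i ∩ P_i|/|P_i|. -/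
open MeasureTheory

/-- A piecewise uniform preference set: a finite union of closed intervals inside `[0,1]`
with positive total length. -/
def PWUniform (P : Set ℝ) : Prop :=
  (∃ (m : ℕ) (a b : Fin m → ℝ), P = ⋃ k, Set.Icc (a k) (b k)) ∧
    P ⊆ Set.Icc 0 1 ∧ 0 < volume P

/-- The Length Game precedence order: `i ≺ j` iff `|S i| < |S j|`, or `|S i| = |S j|`
and `i < j`. -/
def lgPrec {n : ℕ} (S : Fin n → Set ℝ) (i j : Fin n) : Prop :=
  volume (S i) < volume (S j) ∨ (volume (S i) = volume (S j) ∧ i < j)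

/-- The Length Game allocation: `A i = S i \ ⋃_{j ≺ i} S j`. -/
def lgAlloc {n : ℕ} (S : Fin n → Set ℝ) (i : Fin n) : Set ℝ :=
  S i \ ⋃ (j) (_ : lgPrec S j i), S j

/-- A valid Length Game strategy: a measurable subset of the cake `[0,1]`. -/
def IsStrategy (S : Set ℝ) : Prop :=
  MeasurableSet S ∧ S ⊆ Set.Icc 0 1

/-- A profile is in equilibrium if no agent can strictly increase their utility by
unilaterally switching to another strategy. -/
def lgEquilibrium {n : ℕ} (P S : Fin n → Set ℝ) : Prop :=
  ¬ ∃ (i : Fin n) (S' : Set ℝ), IsStrategy S' ∧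
    pwUtil (P i) (lgAlloc S i) < pwUtil (P i) (lgAlloc (Function.update S i S') i)

theorem PWUniform.measurableSet {P : Set ℝ} (hP : PWUniform P) : MeasurableSet P := by
  obtain ⟨⟨m, a, b, rfl⟩, -, -⟩ := hP
  exact .iUnion fun _ => measurableSet_Icc

theorem PWUniform.volume_ne_top {P : Set ℝ} (hP : PWUniform P) : volume P ≠ ⊤ :=
  measure_ne_top_of_subset hP.2.1 (by simp)

theorem PWUniform.volume_real_pos {P : Set ℝ} (hP : PWUniform P) : 0 < volume.real P :=
  ENNReal.toReal_pos hP.2.2.ne' hP.volume_ne_top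

theorem lgPrec_iff_toLex_lt {n : ℕ} (S : Fin n → Set ℝ) (i j : Fin n) :
    lgPrec S i j ↔ toLex (volume (S i), i) < toLex (volume (S j), j) := by
  rw [Prod.Lex.toLex_lt_toLex, lgPrec]

theorem lgAlloc_subset {n : ℕ} (S : Fin n → Set ℝ) (i : Fin n) : lgAlloc S i ⊆ S i :=
  Set.sdiff_subset

theorem measurableSet_lgAlloc {n : ℕ} {S : Fin n → Set ℝ} (hS : ∀ i, MeasurableSet (S i))
    (i : Fin n) : MeasurableSet (lgAlloc S i) :=
  (hS i).diff (.iUnion fun j => .iUnion fun _ => hS j)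

/-- Every desired point is allocated to its first claimant. -/
theorem exists_mem_lgAlloc {n : ℕ} {S : Fin n → Set ℝ} {i : Fin n} {x : ℝ} (hx : x ∈ S i) :
    ∃ j, x ∈ lgAlloc S j := by
  classical
  obtain ⟨j, hj, hmin⟩ := Finset.exists_min_image (Finset.univ.filter fun j => x ∈ S j)
    (fun j => toLex (volume (S j), j)) ⟨i, by simpa using hx⟩
  simp only [Finset.mem_filter, Finset.mem_univ, true_and] at hj hmin
  refine ⟨j, hj, ?_⟩
  simp only [Set.mem_iUnion, not_exists]
  intro k hk hxk
  exact ((lgPrec_iff_toLex_lt S k j).1 hk).not_ge (hmin k hxk)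

/-- A point allocated to `j` is desired only by agents whose sets are at least as long. -/
theorem volume_le_of_mem_lgAlloc {n : ℕ} {S : Fin n → Set ℝ} {i j : Fin n} {x : ℝ}
    (hi : x ∈ S i) (hj : x ∈ lgAlloc S j) : volume (S j) ≤ volume (S i) := by
  by_contra! h
  exact hj.2 (Set.mem_iUnion₂.2 ⟨i, Or.inl h, hi⟩)

/-- With sincere agents, the Length Game produces a utilitarian optimal allocation. -/
theorem length_game_sincere_utilitarian_optimal {n : ℕ}
    (P : Fin n → Set ℝ) (hP : ∀ i, PWUniform (P i)) :
    ∀ B : Fin n → Set ℝ, (∀ i, MeasurableSet (B i)) → (∀ i, B i ⊆ Set.Icc 0 1) →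
      (∀ i j, i ≠ j → Disjoint (B i) (B j)) →
      ∑ i, pwUtil (P i) (B i) ≤ ∑ i, pwUtil (P i) (lgAlloc P i) := by
  intro B hB _ hdisj
  have hA : ∀ j, volume (lgAlloc P j) ≠ ⊤ := fun j =>
    measure_ne_top_of_subset (lgAlloc_subset P j) (hP j).volume_ne_top
  have hAB : ∀ i j, volume (B i ∩ lgAlloc P j) ≠ ⊤ := fun i j =>
    measure_ne_top_of_subset Set.inter_subset_right (hA j)
  have hsplit : ∀ i, volume.real (B i ∩ P i) ≤
      ∑ j, volume.real (B i ∩ P i ∩ lgAlloc P j) := by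
    intro i
    refine (measureReal_mono ?_ ?_).trans (measureReal_iUnion_fintype_le _)
    · intro x hx
      obtain ⟨j, hj⟩ := exists_mem_lgAlloc hx.2
      exact Set.mem_iUnion.2 ⟨j, hx, hj⟩
    · exact measure_ne_top_of_subset (Set.iUnion_subset fun j =>
        Set.inter_subset_left.trans Set.inter_subset_right) (hP i).volume_ne_top
  have hpiece : ∀ i j, volume.real (B i ∩ P i ∩ lgAlloc P j) / volume.real (P i) ≤
      volume.real (B i ∩ lgAlloc P j) / volume.real (P j) := by
    intro i j
    rcases (B i ∩ P i ∩ lgAlloc P j).eq_empty_or_nonempty with h | ⟨x, hx⟩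
    · rw [h, measureReal_empty, zero_div]
      positivity
    · exact div_le_div₀ measureReal_nonneg
        (measureReal_mono (Set.inter_subset_inter_left _ Set.inter_subset_left) (hAB i j))
        (hP j).volume_real_pos
        (ENNReal.toReal_mono (hP i).volume_ne_top (volume_le_of_mem_lgAlloc hx.1.2 hx.2))
  have hcollect : ∀ j, ∑ i, volume.real (B i ∩ lgAlloc P j) ≤ volume.real (lgAlloc P j) := by
    intro j
    rw [← measureReal_iUnion_fintype
      (fun i k hik => (hdisj i k hik).mono Set.inter_subset_left Set.inter_subset_left)
      (fun i => (hB i).inter (measurableSet_lgAlloc (fun k => (hP k).measurableSet) j))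
      (fun i => hAB i j)]
    exact measureReal_mono (Set.iUnion_subset fun i => Set.inter_subset_right) (hA j)
  calc ∑ i, pwUtil (P i) (B i)
      ≤ ∑ i, ∑ j, volume.real (B i ∩ lgAlloc P j) / volume.real (P j) := by
        refine Finset.sum_le_sum fun i _ => ?_
        refine (div_le_div_of_nonneg_right (hsplit i) measureReal_nonneg).trans ?_
        rw [Finset.sum_div]
        exact Finset.sum_le_sum fun j _ => hpiece i j
    _ = ∑ j, (∑ i, volume.real (B i ∩ lgAlloc P j)) / volume.real (P j) := by
        rw [Finset.sum_comm]
        simp_rw [Finset.sum_div]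
    _ ≤ ∑ j, pwUtil (P j) (lgAlloc P j) := by
        refine Finset.sum_le_sum fun j _ => ?_
        rw [pwUtil, Set.inter_eq_left.2 (lgAlloc_subset P j)]
        exact div_le_div_of_nonneg_right (hcollect j) measureReal_nonneg
end

section
/- Given any profile of the Length Game, there exists a reduced profile producing the same allocation: if (S_1,...,S_n) is a profile with resulting allocation (A_1,...,A_n), then the profile (A_1,...,A_n) is reduced (its strategies are pairwise disjoint) and the Length Game applied to the profile (A_1,...,A_n) produces exactly the allocation (A_1,...,A_n). -/
open MeasureTheory

theorem lgPrec_or_lgPrec {n : ℕ} (S : Fin n → Set ℝ) {i j : Fin n} (h : i ≠ j) :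
    lgPrec S i j ∨ lgPrec S j i := by
  unfold lgPrec
  rcases lt_trichotomy (volume (S i)) (volume (S j)) with hv | hv | hv
  · exact Or.inl (Or.inl hv)
  · rcases lt_or_gt_of_ne h with hij | hij
    · exact Or.inl (Or.inr ⟨hv, hij⟩)
    · exact Or.inr (Or.inr ⟨hv.symm, hij⟩)
  · exact Or.inr (Or.inl hv)

theorem disjoint_lgAlloc_of_lgPrec {n : ℕ} (S : Fin n → Set ℝ) {i j : Fin n}
    (h : lgPrec S i j) : Disjoint (lgAlloc S i) (lgAlloc S j) :=
  Set.disjoint_left.2 fun _ hi hj => hj.2 (Set.mem_iUnion₂.2 ⟨i, h, hi.1⟩)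

theorem disjoint_lgAlloc {n : ℕ} (S : Fin n → Set ℝ) {i j : Fin n} (h : i ≠ j) :
    Disjoint (lgAlloc S i) (lgAlloc S j) :=
  (lgPrec_or_lgPrec S h).elim (disjoint_lgAlloc_of_lgPrec S)
    fun hji => (disjoint_lgAlloc_of_lgPrec S hji).symm

theorem not_lgPrec_self {n : ℕ} (S : Fin n → Set ℝ) (i : Fin n) : ¬ lgPrec S i i := by
  simp [lgPrec]

theorem lgAlloc_eq_self_of_pairwise_disjoint {n : ℕ} {S : Fin n → Set ℝ}
    (hS : ∀ i j, i ≠ j → Disjoint (S i) (S j)) (i : Fin n) : lgAlloc S i = S i := by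
  refine (Set.disjoint_iUnion₂_right.2 fun j hj => hS i j ?_).sdiff_eq_left
  rintro rfl
  exact not_lgPrec_self S i hj

/-- Given any profile of the Length Game, the resulting allocation, viewed as a profile,
is reduced (its strategies are pairwise disjoint) and produces exactly the same
allocation. -/
theorem length_game_reduced_profile {n : ℕ}
    (P : Fin n → Set ℝ) (hP : ∀ i, PWUniform (P i))
    (S : Fin n → Set ℝ) (hS : ∀ i, IsStrategy (S i)) :
    (∀ i j, i ≠ j → Disjoint (lgAlloc S i) (lgAlloc S j)) ∧
    (∀ i, lgAlloc (lgAlloc S) i = lgAlloc S i) := by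
  exact ⟨fun _ _ => disjoint_lgAlloc S,
    lgAlloc_eq_self_of_pairwise_disjoint fun _ _ => disjoint_lgAlloc S⟩
end

section
/- Every piecewise uniform cake cutting situation admits a well behaved reduced equilibrium of the Length Game: for every piecewise uniform preference profile (P_1,...,P_n), there exists a profile (S_1,...,S_n) that is reduced, well behaved, and in equilibrium; equivalently, there exist pairwise disjoint measurable sets S_i ⊆ P_i with |(⋃_{i=1}^n P_i) \ (⋃_{i=1}^n S_i)| = 0 and such that whenever |S_i ∩ P_j| > 0 for i ≠ j, |S_i| ≤ |S_j|. -/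
open MeasureTheory

/-- A measurable subset of the unit interval has measurable subsets of every smaller length. -/
lemma exists_measurable_subset_volume_real_eq {D : Set ℝ} (hD : MeasurableSet D)
    (hD01 : D ⊆ Set.Icc 0 1) {w : ℝ} (hw0 : 0 ≤ w) (hw : w ≤ volume.real D) :
    ∃ B ⊆ D, MeasurableSet B ∧ volume.real B = w := by
  have hfin : ∀ X ⊆ D, volume X ≠ ⊤ := fun X hX =>
    measure_ne_top_of_subset (hX.trans hD01) (by simp)
  have hlip : LipschitzWith 1 fun t : ℝ => volume.real (D ∩ Set.Iic t) := by
    refine LipschitzWith.of_le_add fun t s => ?_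
    have hsub : D ∩ Set.Iic t ⊆ (D ∩ Set.Iic s) ∪ Set.Icc s t := by
      rintro y ⟨hy, hyt⟩
      rcases le_total y s with h | h
      · exact Or.inl ⟨hy, h⟩
      · exact Or.inr ⟨h, hyt⟩
    have h1 := measureReal_mono (μ := volume) hsub
      ((measure_union_lt_top (hfin _ Set.inter_subset_left).lt_top (by simp)).ne)
    have h2 := measureReal_union_le (μ := volume) (D ∩ Set.Iic s) (Set.Icc s t)
    have h3 : volume.real (Set.Icc s t) ≤ dist t s := by
      rw [Measure.real, Real.volume_Icc, ENNReal.toReal_ofReal', Real.dist_eq]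
      exact max_le (le_abs_self _) (abs_nonneg _)
    linarith
  have h0 : volume.real (D ∩ Set.Iic 0) = 0 := by
    have hsub : D ∩ Set.Iic 0 ⊆ {0} := fun y hy => le_antisymm hy.2 (hD01 hy.1).1
    rw [Measure.real, measure_mono_null hsub (by simp), ENNReal.toReal_zero]
  have h1 : D ∩ Set.Iic 1 = D := Set.inter_eq_left.2 fun y hy => (hD01 hy).2
  obtain ⟨t, -, ht⟩ := intermediate_value_Icc zero_le_one hlip.continuous.continuousOn
    (show w ∈ Set.Icc (volume.real (D ∩ Set.Iic 0)) (volume.real (D ∩ Set.Iic 1)) by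
      rw [h0, h1]; exact ⟨hw0, hw⟩)
  exact ⟨D ∩ Set.Iic t, Set.inter_subset_left, hD.inter measurableSet_Iic, ht⟩

/-- A measurable subset of the unit interval can be cut into disjoint pieces of prescribed
lengths. -/
lemma exists_disjoint_pieces {ι : Type*} [DecidableEq ι] (w : ι → ℝ) (hw : ∀ i, 0 ≤ w i)
    (s : Finset ι) {D : Set ℝ} (hD : MeasurableSet D) (hD01 : D ⊆ Set.Icc 0 1)
    (hs : ∑ i ∈ s, w i ≤ volume.real D) :
    ∃ Q : ι → Set ℝ, (∀ i, MeasurableSet (Q i)) ∧ (∀ i, Q i ⊆ D) ∧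
      Pairwise (Function.onFun Disjoint Q) ∧ ∀ i ∈ s, volume.real (Q i) = w i := by
  induction s using Finset.induction_on generalizing D with
  | empty => exact ⟨fun _ => ∅, by simp, by simp, fun _ _ _ => by simp [Function.onFun], by simp⟩
  | insert a s ha ih =>
    rw [Finset.sum_insert ha] at hs
    have hnn : 0 ≤ ∑ i ∈ s, w i := Finset.sum_nonneg fun i _ => hw i
    obtain ⟨B, hBD, hB, hBw⟩ :=
      exists_measurable_subset_volume_real_eq hD hD01 (hw a) (by linarith)
    have hfin : volume D ≠ ⊤ := measure_ne_top_of_subset hD01 (by simp)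
    have hdiff := measureReal_sdiff (μ := volume) hBD hB hfin
    obtain ⟨Q, hQm, hQD, hQd, hQw⟩ :=
      ih (hD.diff hB) (Set.sdiff_subset.trans hD01) (by rw [hdiff]; linarith)
    have hQB : ∀ i, Disjoint (Q i) B := fun i => Set.disjoint_sdiff_left.mono_left (hQD i)
    refine ⟨Function.update Q a B, fun i => ?_, fun i => ?_, fun i j hij => ?_, fun i hi => ?_⟩
    · rcases eq_or_ne i a with rfl | h <;> simp [*]
    · rcases eq_or_ne i a with rfl | h
      · simpa
      · simpa [h] using (hQD i).trans Set.sdiff_subset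
    · rcases eq_or_ne i a with rfl | h
      · simpa [Function.onFun, hij.symm] using (hQB j).symm
      · rcases eq_or_ne j a with rfl | h'
        · simpa [Function.onFun, h] using hQB i
        · simpa [Function.onFun, h, h'] using hQd hij
    · rcases eq_or_ne i a with rfl | h
      · simpa
      · simpa [h] using hQw i ((Finset.mem_insert.1 hi).resolve_left h)

/-- Amounts `c a` can be distributed among admissible recipients `R a` so that a recipient of
a positive share of `a` has at most the total share of every other admissible recipient. -/
lemma exists_balanced_distribution {α ι : Type*} [Fintype α] [Fintype ι] [DecidableEq α]
    [DecidableEq ι] (c : α → ℝ) (hc : ∀ a, 0 ≤ c a) (R : α → Finset ι)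
    (hR : ∀ a, (R a).Nonempty) :
    ∃ x : α → ι → ℝ, (∀ a i, 0 ≤ x a i) ∧ (∀ a i, i ∉ R a → x a i = 0) ∧
      (∀ a, ∑ i, x a i = c a) ∧
      ∀ a i j, 0 < x a i → j ∈ R a → ∑ b, x b i ≤ ∑ b, x b j := by
  let K : Set (α → ι → ℝ) :=
    {x | (∀ a i, 0 ≤ x a i) ∧ (∀ a i, i ∉ R a → x a i = 0) ∧ ∀ a, ∑ i, x a i = c a}
  have hKclosed : IsClosed K := by
    simp only [K, Set.ofPred_and, Set.ofPred_forall]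
    refine IsClosed.inter ?_ (IsClosed.inter ?_ ?_)
    · exact isClosed_iInter fun a => isClosed_iInter fun i =>
        isClosed_le (by fun_prop) (by fun_prop)
    · exact isClosed_iInter fun a => isClosed_iInter fun i => isClosed_iInter fun _ =>
        isClosed_eq (by fun_prop) (by fun_prop)
    · exact isClosed_iInter fun a => isClosed_eq (by fun_prop) (by fun_prop)
  have hKcompact : IsCompact K := by
    refine (isCompact_univ_pi fun a => isCompact_univ_pi fun _ : ι =>
      (isCompact_Icc : IsCompact (Set.Icc 0 (c a)))).of_isClosed_subset hKclosed ?_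
    rintro x ⟨h0, -, hs⟩ a - i -
    exact ⟨h0 a i, hs a ▸ Finset.single_le_sum (fun k _ => h0 a k) (Finset.mem_univ i)⟩
  have hKne : K.Nonempty := by
    choose r hr using hR
    refine ⟨fun a => Pi.single (r a) (c a), fun a i => ?_, fun a i hi => ?_, fun a => ?_⟩
    · rcases eq_or_ne i (r a) with rfl | h <;> simp [*]
    · have h : i ≠ r a := fun h => hi (h ▸ hr a)
      simp [h]
    · simp
  obtain ⟨x, ⟨hx0, hxR, hxc⟩, hmin⟩ := hKcompact.exists_isMinOn hKne
    (f := fun x => ∑ i, (∑ a, x a i) ^ 2) (by fun_prop)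
  refine ⟨x, hx0, hxR, hxc, fun a i j hi hj => ?_⟩
  by_contra! hlt
  have hij : i ≠ j := by rintro rfl; exact lt_irrefl _ hlt
  obtain ⟨ε, hε, hεx, hεL⟩ : ∃ ε > 0, ε ≤ x a i ∧ ε < ∑ b, x b i - ∑ b, x b j := by
    refine ⟨min (x a i) ((∑ b, x b i - ∑ b, x b j) / 2), lt_min hi (by linarith),
      min_le_left _ _, (min_le_right _ _).trans_lt (by linarith)⟩
  let d : ι → ℝ := Pi.single j 1 - Pi.single i 1
  have hd : ∑ k, d k = 0 := by simp [d]
  have hdi : d i = -1 := by simp [d, hij]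
  have hdj : d j = 1 := by simp [d, hij.symm]
  have hdk : ∀ k, k ≠ i → k ≠ j → d k = 0 := fun k h h' => by simp [d, h, h']
  let y : α → ι → ℝ := fun b k => x b k + if b = a then ε * d k else 0
  have hy : y ∈ K := by
    refine ⟨fun b k => ?_, fun b k hk => ?_, fun b => ?_⟩
    · by_cases hb : b = a
      · subst hb
        have := hx0 b k
        rcases eq_or_ne k i with rfl | h
        · simp only [y, if_true, hdi]; linarith
        rcases eq_or_ne k j with rfl | h'
        · simp only [y, if_true, hdj]; linarith
        simpa [y, hdk k h h'] using this
      · simpa [y, hb] using hx0 b k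
    · by_cases hb : b = a
      · subst hb
        have h : k ≠ i := by rintro rfl; exact hi.ne' (hxR b k hk)
        have h' : k ≠ j := by rintro rfl; exact hk hj
        simp [y, hdk k h h', hxR b k hk]
      · simp [y, hb, hxR b k hk]
    · by_cases hb : b = a
      · simp [y, hb, Finset.sum_add_distrib, ← Finset.mul_sum, hd, hxc]
      · simp [y, hb, hxc]
  have hle : ∑ k, (∑ b, x b k) ^ 2 ≤ ∑ k, (∑ b, y b k) ^ 2 := hmin hy
  have hsum : ∀ k, (∑ b, y b k) ^ 2 =
      (∑ b, x b k) ^ 2 + (2 * ε * (∑ b, x b k) * d k + ε ^ 2 * (d k * d k)) := fun k => by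
    simp only [y, Finset.sum_add_distrib, Finset.sum_ite_eq', Finset.mem_univ, if_true]
    ring
  have hlin : ∀ g : ι → ℝ, ∑ k, g k * d k = g j - g i := fun g => by
    simp [d, mul_sub, Finset.sum_sub_distrib, Pi.single_apply]
  simp only [hsum, Finset.sum_add_distrib, ← Finset.mul_sum, hlin, hdi, hdj] at hle
  nlinarith

/-- A disjoint profile that allocates all valued cake, and in which a piece valued by another
agent is never longer than that agent's own piece, is an equilibrium. -/
lemma lgEquilibrium_of_balanced {n : ℕ} {P S : Fin n → Set ℝ}
    (hfin : ∀ i, volume (P i) ≠ ⊤) (hSP : ∀ i, S i ⊆ P i) (halloc : ∀ i, S i = lgAlloc S i)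
    (hfull : volume ((⋃ i, P i) \ ⋃ i, S i) = 0)
    (hbal : ∀ i j, i ≠ j → 0 < volume (S i ∩ P j) → volume (S i) ≤ volume (S j)) :
    lgEquilibrium P S := by
  rintro ⟨i, S', -, hlt⟩
  rw [← halloc i] at hlt
  have hvol : volume (S i) < volume (lgAlloc (Function.update S i S') i ∩ P i) := by
    by_contra! h
    refine hlt.not_ge ?_
    unfold pwUtil
    rw [Set.inter_eq_left.2 (hSP i)]
    exact div_le_div_of_nonneg_right
      (ENNReal.toReal_mono (measure_ne_top_of_subset (hSP i) (hfin i)) h) ENNReal.toReal_nonneg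
  have hS' : volume (S i) < volume S' := by
    refine hvol.trans_le (measure_mono ?_)
    rintro y ⟨⟨hy, -⟩, -⟩
    simpa using hy
  have hsub : lgAlloc (Function.update S i S') i ∩ P i ⊆
      S i ∪ (((⋃ i, P i) \ ⋃ i, S i) ∪ ⋃ j, ⋃ (_ : volume (S j ∩ P i) = 0), S j ∩ P i) := by
    rintro y ⟨⟨-, hyn⟩, hyP⟩
    by_cases hyS : y ∈ ⋃ j, S j
    · obtain ⟨j, hj⟩ := Set.mem_iUnion.1 hyS
      rcases eq_or_ne j i with rfl | hji
      · exact Or.inl hj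
      refine Or.inr (Or.inr ?_)
      simp only [Set.mem_iUnion]
      refine ⟨j, ?_, hj, hyP⟩
      by_contra hpos
      refine hyn ?_
      simp only [Set.mem_iUnion]
      refine ⟨j, Or.inl ?_, by simpa [hji] using hj⟩
      simpa [hji] using (hbal j i hji (pos_iff_ne_zero.2 hpos)).trans_lt hS'
    · exact Or.inr (Or.inl ⟨Set.mem_iUnion.2 ⟨i, hyP⟩, hyS⟩)
  have hnull : volume (((⋃ i, P i) \ ⋃ i, S i) ∪
      ⋃ j, ⋃ (_ : volume (S j ∩ P i) = 0), S j ∩ P i) = 0 :=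
    measure_union_null hfull (measure_iUnion_null fun j => measure_iUnion_null fun h => h)
  refine hvol.not_ge ((measure_mono hsub).trans ((measure_union_le _ _).trans ?_))
  rw [hnull, add_zero]

/-- Measurable preferences admit a balanced disjoint profile allocating all valued cake. -/
lemma exists_balanced_profile {ι : Type*} [Fintype ι] [DecidableEq ι] {P : ι → Set ℝ}
    (hPm : ∀ i, MeasurableSet (P i)) (hP01 : ∀ i, P i ⊆ Set.Icc 0 1) :
    ∃ S : ι → Set ℝ, (∀ i, MeasurableSet (S i)) ∧ (∀ i, S i ⊆ P i) ∧
      (∀ i j, i ≠ j → Disjoint (S i) (S j)) ∧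
      volume ((⋃ i, P i) \ ⋃ i, S i) = 0 ∧
      ∀ i j, i ≠ j → 0 < volume (S i ∩ P j) → volume (S i) ≤ volume (S j) := by
  let D : {T : Finset ι // T.Nonempty} → Set ℝ := fun T => {y | ∀ i, y ∈ P i ↔ i ∈ T.1}
  have hDm : ∀ T, MeasurableSet (D T) := fun T => by
    simp only [D, Set.ofPred_forall]
    refine MeasurableSet.iInter fun i => ?_
    by_cases hi : i ∈ T.1
    · simp only [hi, iff_true]
      exact hPm i
    · simp only [hi, iff_false]
      exact (hPm i).compl
  have hD01 : ∀ T, D T ⊆ Set.Icc 0 1 := fun T y hy => by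
    obtain ⟨i, hi⟩ := T.2
    exact hP01 i ((hy i).2 hi)
  have hDd : Pairwise (Function.onFun Disjoint D) := fun T T' hne => by
    refine Set.disjoint_left.2 fun y hy hy' => hne (Subtype.ext (Finset.ext fun i => ?_))
    rw [← hy i, hy' i]
  have hDfin : ∀ T, volume (D T) ≠ ⊤ := fun T => measure_ne_top_of_subset (hD01 T) (by simp)
  obtain ⟨x, hx0, hxR, hxc, hxbal⟩ := exists_balanced_distribution (fun T => volume.real (D T))
    (fun _ => measureReal_nonneg) Subtype.val (fun T => T.2)
  choose Q hQm hQD hQd hQw using fun T =>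
    exists_disjoint_pieces (x T) (hx0 T) Finset.univ (hDm T) (hD01 T) (hxc T).le
  have hQfin : ∀ T i, volume (Q T i) ≠ ⊤ := fun T i => measure_ne_top_of_subset (hQD T i) (hDfin T)
  have hQcross : ∀ T T' i j, T ≠ T' → Disjoint (Q T i) (Q T' j) := fun T T' i j h =>
    (hDd h).mono (hQD T i) (hQD T' j)
  have hQP : ∀ T i, volume.real (P i ∩ Q T i) = x T i := fun T i => by
    by_cases hi : i ∈ T.1
    · rw [Set.inter_eq_right.2 fun y hy => (hQD T i hy i).2 hi, hQw T i (Finset.mem_univ i)]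
    · have hsub : P i ∩ Q T i ⊆ ∅ := fun y hy => hi ((hQD T i hy.2 i).1 hy.1)
      rw [Set.subset_empty_iff.1 hsub, measureReal_empty, hxR T i hi]
  have hm : ∀ T i, MeasurableSet (P i ∩ Q T i) := fun T i => (hPm i).inter (hQm T i)
  have hfin : ∀ T i, volume (P i ∩ Q T i) ≠ ⊤ := fun T i =>
    measure_ne_top_of_subset Set.inter_subset_right (hQfin T i)
  have hSvol : ∀ i, volume (⋃ T, P i ∩ Q T i) = ENNReal.ofReal (∑ T, x T i) := fun i => by
    rw [measure_iUnion (fun T T' h => (hQcross T T' i i h).mono Set.inter_subset_right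
      Set.inter_subset_right) (fun T => hm T i), tsum_fintype,
      ENNReal.ofReal_sum_of_nonneg fun T _ => hx0 T i]
    refine Finset.sum_congr rfl fun T _ => ?_
    rw [← hQP T i, ofReal_measureReal (hfin T i)]
  refine ⟨fun i => ⋃ T, P i ∩ Q T i, fun i => MeasurableSet.iUnion fun T => hm T i,
    fun i => Set.iUnion_subset fun T => Set.inter_subset_left, fun i j hij => ?_, ?_,
    fun i j _ hpos => ?_⟩
  · refine Set.disjoint_iUnion_left.2 fun T => Set.disjoint_iUnion_right.2 fun T' => ?_
    refine Disjoint.mono Set.inter_subset_right Set.inter_subset_right ?_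
    rcases eq_or_ne T T' with rfl | h
    · exact hQd T hij
    · exact hQcross T T' i j h
  · have hsub : ((⋃ i, P i) \ ⋃ i, ⋃ T, P i ∩ Q T i) ⊆ ⋃ T, D T \ ⋃ i, P i ∩ Q T i := by
      classical
      rintro y ⟨hy, hyn⟩
      obtain ⟨i, hi⟩ := Set.mem_iUnion.1 hy
      refine Set.mem_iUnion.2 ⟨⟨Finset.univ.filter fun k => y ∈ P k, i, by simpa using hi⟩,
        fun k => by simp, fun hyS => hyn ?_⟩
      obtain ⟨k, hk⟩ := Set.mem_iUnion.1 hyS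
      exact Set.mem_iUnion.2 ⟨k, Set.mem_iUnion.2 ⟨_, hk⟩⟩
    refine measure_mono_null hsub (measure_iUnion_null fun T => ?_)
    have hUD : (⋃ i, P i ∩ Q T i) ⊆ D T :=
      Set.iUnion_subset fun i => Set.inter_subset_right.trans (hQD T i)
    have hU : volume (⋃ i, P i ∩ Q T i) = volume (D T) := by
      rw [measure_iUnion (fun i j h => (hQd T h).mono Set.inter_subset_right
        Set.inter_subset_right) (fun i => hm T i), tsum_fintype, ← ofReal_measureReal (hDfin T),
        ← hxc T, ENNReal.ofReal_sum_of_nonneg fun i _ => hx0 T i]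
      refine Finset.sum_congr rfl fun i _ => ?_
      rw [← hQP T i, ofReal_measureReal (hfin T i)]
    rw [measure_sdiff hUD (MeasurableSet.iUnion fun i => hm T i).nullMeasurableSet
      (hU ▸ hDfin T), hU, tsub_self]
  · rw [hSvol, hSvol]
    refine ENNReal.ofReal_le_ofReal ?_
    rw [Set.iUnion_inter] at hpos
    obtain ⟨T, hT⟩ : ∃ T, volume (P i ∩ Q T i ∩ P j) ≠ 0 := by
      by_contra! h
      exact hpos.ne' (measure_iUnion_null h)
    obtain ⟨y, hy, hyj⟩ := nonempty_of_measure_ne_zero hT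
    refine hxbal T i j ?_ ((hQD T i hy.2 j).1 hyj)
    rw [← hQP T i]
    exact ENNReal.toReal_pos (fun h => hT (measure_mono_null Set.inter_subset_left h)) (hfin T i)

/-- Every piecewise uniform cake cutting situation admits a well behaved reduced
equilibrium of the Length Game; moreover such a profile consists of pairwise disjoint
sets `S i ⊆ P i` allocating all the valued cake, with `|S i ∩ P j| > 0` for `i ≠ j`
implying `|S i| ≤ |S j|`. -/
theorem length_game_equilibrium_exists {n : ℕ}
    (P : Fin n → Set ℝ) (hP : ∀ i, PWUniform (P i)) :
    ∃ S : Fin n → Set ℝ, (∀ i, IsStrategy (S i)) ∧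
      (∀ i, S i = lgAlloc S i) ∧
      (∀ i, S i ⊆ P i) ∧
      lgEquilibrium P S ∧
      (∀ i j, i ≠ j → Disjoint (S i) (S j)) ∧
      volume ((⋃ i, P i) \ ⋃ i, S i) = 0 ∧
      (∀ i j, i ≠ j → 0 < volume (S i ∩ P j) → volume (S i) ≤ volume (S j)) := by
  have hPm : ∀ i, MeasurableSet (P i) := fun i => by
    obtain ⟨⟨m, a, b, h⟩, -⟩ := hP i
    rw [h]
    exact MeasurableSet.iUnion fun _ => measurableSet_Icc
  have hP01 : ∀ i, P i ⊆ Set.Icc 0 1 := fun i => (hP i).2.1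
  obtain ⟨S, hSm, hSP, hSd, hfull, hbal⟩ := exists_balanced_profile hPm hP01
  have hirrefl : ∀ i j, lgPrec S j i → j ≠ i := by
    rintro i j h rfl
    rcases h with h | ⟨-, h⟩ <;> exact lt_irrefl _ h
  have halloc : ∀ i, S i = lgAlloc S i := fun i => by
    refine (sdiff_eq_left.2 ?_).symm
    exact Set.disjoint_iUnion_right.2 fun j => Set.disjoint_iUnion_right.2 fun h =>
      hSd i j (hirrefl i j h).symm
  exact ⟨S, fun i => ⟨hSm i, (hSP i).trans (hP01 i)⟩, halloc, hSP,
    lgEquilibrium_of_balanced (fun i => measure_ne_top_of_subset (hP01 i) (by simp)) hSP halloc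
      hfull hbal, hSd, hfull, hbal⟩
end
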